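/- arXiv:2007.09765 — 2 statements merged into one kernel-verified Lean document; each statement's English description precedes it below -/
import Mathlib

section
/- Let K be a cap body of the unit ball in E^3 that is centrally symmetric, i.e., its vertex set satisfies V = -V. Then there exist six unit vectors u_1, …, u_6 ∈ S^2 such that every boundary point of K is illuminated by at least one u_j (i.e., for every p ∈ ∂K there are j and λ > 0 with p + λu_j ∈ int K). In other words, the illumination number of a centrally symmetric cap body of a ball in E^3 is at most 6. -/
open scoped RealInnerProductSpace

/-- Abbreviation-free orthonormal frame adapted to two vectors. -/
lemma exists_frame (v w : EuclideanSpace ℝ (Fin 3)) :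
    ∃ b : OrthonormalBasis (Fin 3) ℝ (EuclideanSpace ℝ (Fin 3)),
      ⟪b 1, v⟫ = 0 ∧ ⟪b 2, v⟫ = 0 ∧ ⟪b 2, w⟫ = 0 := by
  have h : Module.finrank ℝ (EuclideanSpace ℝ (Fin 3)) = Fintype.card (Fin 3) := by simp
  refine ⟨InnerProductSpace.gramSchmidtOrthonormalBasis h ![v, w, 0], ?_, ?_, ?_⟩
  · exact InnerProductSpace.gramSchmidtOrthonormalBasis_inv_triangular h
      (f := ![v, w, 0]) (i := 0) (j := 1) (by decide)
  · exact InnerProductSpace.gramSchmidtOrthonormalBasis_inv_triangular h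
      (f := ![v, w, 0]) (i := 0) (j := 2) (by decide)
  · exact InnerProductSpace.gramSchmidtOrthonormalBasis_inv_triangular h
      (f := ![v, w, 0]) (i := 1) (j := 2) (by decide)

lemma frame_norm_sq (b : OrthonormalBasis (Fin 3) ℝ (EuclideanSpace ℝ (Fin 3)))
    (x : EuclideanSpace ℝ (Fin 3)) :
    ‖x‖ ^ 2 = ⟪b 0, x⟫ ^ 2 + ⟪b 1, x⟫ ^ 2 + ⟪b 2, x⟫ ^ 2 := by
  rw [← b.sum_sq_norm_inner_right x, Fin.sum_univ_three]
  simp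

lemma frame_inner (b : OrthonormalBasis (Fin 3) ℝ (EuclideanSpace ℝ (Fin 3)))
    (x y : EuclideanSpace ℝ (Fin 3)) :
    ⟪x, y⟫ = ⟪b 0, x⟫ * ⟪b 0, y⟫ + ⟪b 1, x⟫ * ⟪b 1, y⟫ + ⟪b 2, x⟫ * ⟪b 2, y⟫ := by
  rw [← b.sum_inner_mul_inner x y, Fin.sum_univ_three]
  simp [real_inner_comm]

/-- The segment condition, for vertices with large caps, bounds the inner product. -/
lemma inner_le_half (v w : EuclideanSpace ℝ (Fin 3)) (hv : 3 / 2 ≤ ‖v‖ ^ 2)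
    (hw : 3 / 2 ≤ ‖w‖ ^ 2)
    (h : (segment ℝ v w ∩ Metric.closedBall (0 : EuclideanSpace ℝ (Fin 3)) 1).Nonempty) :
    ⟪v, w⟫ ≤ 1 / 2 := by
  obtain ⟨p, ⟨a, c, ha, hc, hac, rfl⟩, hp⟩ := h
  rw [mem_closedBall_zero_iff] at hp
  have h1 : ‖a • v + c • w‖ ^ 2 ≤ 1 := by nlinarith [norm_nonneg (a • v + c • w)]
  rw [norm_add_sq_real, norm_smul, norm_smul, real_inner_smul_left, real_inner_smul_right,
    Real.norm_of_nonneg ha, Real.norm_of_nonneg hc] at h1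
  by_contra! hq
  have e1 : a ^ 2 * (3 / 2) ≤ a ^ 2 * ‖v‖ ^ 2 := by gcongr
  have e2 : c ^ 2 * (3 / 2) ≤ c ^ 2 * ‖w‖ ^ 2 := by gcongr
  have hc' : c = 1 - a := by linarith
  have e3 : a * c * (1 / 2) ≤ a * c * ⟪v, w⟫ := by gcongr
  have e4 : a ^ 2 * (3 / 2) + c ^ 2 * (3 / 2) + 2 * (a * c * (1 / 2)) ≤ 1 := by nlinarith
  -- equality forces `a = c = 1/2`
  have ha2 : (a - 1 / 2) ^ 2 ≤ 0 := by subst hc'; nlinarith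
  have ha3 : a = 1 / 2 := by
    have := pow_eq_zero_iff (two_ne_zero) |>.1 (le_antisymm ha2 (sq_nonneg _))
    linarith
  have hc3 : c = 1 / 2 := by linarith
  subst ha3; subst hc3
  nlinarith

lemma frame_small (b : OrthonormalBasis (Fin 3) ℝ (EuclideanSpace ℝ (Fin 3)))
    (x : EuclideanSpace ℝ (Fin 3)) (hx : ‖x‖ ^ 2 < 3 / 2) :
    ∃ k, ‖x‖ ^ 2 - ⟪b k, x⟫ ^ 2 < 1 := by
  by_contra! h
  have := frame_norm_sq b x
  linarith [h 0, h 1, h 2]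

lemma exists_good_frame
    (V : Set (EuclideanSpace ℝ (Fin 3)))
    (hVseg : ∀ v ∈ V, ∀ w ∈ V, v ≠ w →
      (segment ℝ v w ∩ Metric.closedBall (0 : EuclideanSpace ℝ (Fin 3)) 1).Nonempty)
    (hVsym : -V = V) :
    ∃ b : OrthonormalBasis (Fin 3) ℝ (EuclideanSpace ℝ (Fin 3)),
      ∀ v ∈ V, ∃ k, ‖v‖ ^ 2 - ⟪b k, v⟫ ^ 2 < 1 := by
  have hneg : ∀ v ∈ V, -v ∈ V := fun v hv => by rw [← hVsym]; simpa using hv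
  have key : ∀ v ∈ V, ∀ w ∈ V, 3 / 2 ≤ ‖v‖ ^ 2 → 3 / 2 ≤ ‖w‖ ^ 2 → w ≠ v → w ≠ -v →
      ⟪v, w⟫ ^ 2 ≤ 1 / 4 := by
    intro v hv w hw h1 h2 h3 h4
    have a1 := inner_le_half v w h1 h2 (hVseg v hv w hw h3.symm)
    have a2 := inner_le_half (-v) w (by simpa using h1) h2
      (hVseg (-v) (hneg v hv) w hw h4.symm)
    rw [inner_neg_left] at a2
    nlinarith
  by_cases hS : ∃ v ∈ V, 3 / 2 ≤ ‖v‖ ^ 2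
  swap
  · push Not at hS
    obtain ⟨b, -⟩ := exists_frame 0 0
    exact ⟨b, fun v hv => frame_small b v (hS v hv)⟩
  obtain ⟨v, hv, hv2⟩ := hS
  have good1 : ∀ b : OrthonormalBasis (Fin 3) ℝ (EuclideanSpace ℝ (Fin 3)),
      ⟪b 1, v⟫ = 0 → ⟪b 2, v⟫ = 0 → ∀ x, x = v ∨ x = -v →
      ∃ k, ‖x‖ ^ 2 - ⟪b k, x⟫ ^ 2 < 1 := by
    intro b h1 h2 x hx
    have hh := frame_norm_sq b v
    rw [h1, h2] at hh
    refine ⟨0, ?_⟩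
    rcases hx with rfl | rfl
    · linarith
    · simp only [norm_neg, inner_neg_right]
      linarith
  by_cases hT : ∃ w ∈ V, 3 / 2 ≤ ‖w‖ ^ 2 ∧ w ≠ v ∧ w ≠ -v
  swap
  · push Not at hT
    obtain ⟨b, h1, h2, -⟩ := exists_frame v 0
    refine ⟨b, fun x hx => ?_⟩
    rcases lt_or_ge (‖x‖ ^ 2) (3 / 2) with h | h
    · exact frame_small b x h
    · apply good1 b h1 h2
      by_cases hxv : x = v
      · exact Or.inl hxv
      · exact Or.inr (hT x hx h hxv)
  obtain ⟨w, hw, hw2, hwv, hwv'⟩ := hT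
  obtain ⟨b, h1, h2, h3⟩ := exists_frame v w
  refine ⟨b, fun x hx => ?_⟩
  rcases lt_or_ge (‖x‖ ^ 2) (3 / 2) with h | h
  · exact frame_small b x h
  by_cases hxv : x = v ∨ x = -v
  · exact good1 b h1 h2 x hxv
  have nv := frame_norm_sq b v
  have nw := frame_norm_sq b w
  have nx := frame_norm_sq b x
  have qvw := key v hv w hw hv2 hw2 hwv hwv'
  rw [frame_inner b v w, h1, h2] at qvw
  rw [h1, h2] at nv
  rw [h3] at nw
  have A : 3 / 2 ≤ ⟪b 0, v⟫ ^ 2 := by linarith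
  have hα : ⟪b 0, w⟫ ^ 2 ≤ 1 / 6 := by nlinarith [sq_nonneg ⟪b 0, w⟫]
  by_cases hxw : x = w ∨ x = -w
  · refine ⟨1, ?_⟩
    rcases hxw with rfl | rfl
    · linarith
    · simp only [norm_neg, inner_neg_right]
      linarith
  push Not at hxv hxw
  have qvx := key v hv x hx hv2 h hxv.1 hxv.2
  have qwx := key w hw x hx hw2 h hxw.1 hxw.2
  rw [frame_inner b v x, h1, h2] at qvx
  rw [frame_inner b w x, h3] at qwx
  have hx0 : ⟪b 0, x⟫ ^ 2 ≤ 1 / 6 := by nlinarith [sq_nonneg ⟪b 0, x⟫]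
  have hβ : 4 / 3 ≤ ⟪b 1, w⟫ ^ 2 := by linarith
  refine ⟨2, ?_⟩
  generalize ⟪b 0, w⟫ = α at *
  generalize ⟪b 1, w⟫ = β at *
  generalize ⟪b 0, x⟫ = s at *
  generalize ⟪b 1, x⟫ = y at *
  have m1 : |α * s| ≤ 1 / 6 := by
    rw [abs_le]; constructor <;> nlinarith [sq_nonneg (α - s), sq_nonneg (α + s)]
  have m2 : |α * s + β * y| ≤ 1 / 2 := by
    apply abs_le_of_sq_le_sq _ (by norm_num)
    linarith
  have m3 : |β * y| ≤ 2 / 3 := by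
    rw [abs_le] at *; constructor <;> linarith
  have m4 : (β * y) ^ 2 ≤ 4 / 9 := by
    rw [← sq_abs]; nlinarith [abs_nonneg (β * y)]
  have m5 : y ^ 2 ≤ 1 / 3 := by nlinarith [sq_nonneg y]
  linarith

lemma isClosed_capBody (V : Set (EuclideanSpace ℝ (Fin 3))) (hVfin : V.Finite) :
    IsClosed (convexHull ℝ (Metric.closedBall (0 : EuclideanSpace ℝ (Fin 3)) 1 ∪ V)) := by
  rcases V.eq_empty_or_nonempty with rfl | hne
  · rw [Set.union_empty, (convex_closedBall _ _).convexHull_eq]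
    exact Metric.isClosed_closedBall
  rw [convexHull_union ⟨0, by simp⟩ hne, (convex_closedBall _ _).convexHull_eq]
  have hc : IsCompact ((fun q : ℝ × EuclideanSpace ℝ (Fin 3) × EuclideanSpace ℝ (Fin 3) =>
      (1 - q.1) • q.2.1 + q.1 • q.2.2) '' (Set.Icc (0 : ℝ) 1 ×ˢ
        (Metric.closedBall (0 : EuclideanSpace ℝ (Fin 3)) 1 ×ˢ convexHull ℝ V))) :=
    (isCompact_Icc.prod ((isCompact_closedBall _ _).prod
      (hVfin.isCompact_convexHull ℝ))).image (by fun_prop)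
  convert hc.isClosed using 1
  ext z
  simp only [mem_convexJoin, segment_eq_image, Set.mem_image, Set.mem_prod, Prod.exists]
  constructor
  · rintro ⟨x, hx, y, hy, t, ht, rfl⟩
    exact ⟨t, x, y, ⟨ht, hx, hy⟩, rfl⟩
  · rintro ⟨t, x, y, ⟨ht, hx, hy⟩, rfl⟩
    exact ⟨x, hx, y, hy, t, ht, rfl⟩

/-- The six directions: plus and minus the frame vectors. -/
lemma illum_of_frame (V : Set (EuclideanSpace ℝ (Fin 3))) (hVfin : V.Finite)
    (hVout : ∀ v ∈ V, 1 < ‖v‖)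
    (b : OrthonormalBasis (Fin 3) ℝ (EuclideanSpace ℝ (Fin 3)))
    (hb : ∀ v ∈ V, ∃ k, ‖v‖ ^ 2 - ⟪b k, v⟫ ^ 2 < 1)
    (K : Set (EuclideanSpace ℝ (Fin 3)))
    (hK : K = convexHull ℝ (Metric.closedBall (0 : EuclideanSpace ℝ (Fin 3)) 1 ∪ V)) :
    ∀ p ∈ frontier K, ∃ k : Fin 3, ∃ l : ℝ, l ≠ 0 ∧ p + l • b k ∈ interior K := by
  have hKconv : Convex ℝ K := hK ▸ convex_convexHull ℝ _
  have hsub : Metric.closedBall (0 : EuclideanSpace ℝ (Fin 3)) 1 ∪ V ⊆ K :=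
    hK ▸ subset_convexHull ℝ _
  have hball : Metric.ball (0 : EuclideanSpace ℝ (Fin 3)) 1 ⊆ interior K :=
    interior_maximal (Metric.ball_subset_closedBall.trans
      (Set.subset_union_left.trans hsub)) Metric.isOpen_ball
  have hKclosed : IsClosed K := by
    rw [hK]
    exact isClosed_capBody V hVfin
  -- moving along a frame vector into the open ball
  have move : ∀ x : EuclideanSpace ℝ (Fin 3), ∀ k, ‖x‖ ^ 2 - ⟪b k, x⟫ ^ 2 < 1 → 1 ≤ ‖x‖ →
      ∃ l : ℝ, l ≠ 0 ∧ x + l • b k ∈ interior K := by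
    intro x k hx hx1
    refine ⟨-⟪b k, x⟫, ?_, hball ?_⟩
    · intro h0
      rw [neg_eq_zero] at h0
      rw [h0] at hx
      nlinarith
    · rw [mem_ball_zero_iff]
      have : ‖x + (-⟪b k, x⟫) • b k‖ ^ 2 < 1 := by
        rw [norm_add_sq_real, norm_smul, real_inner_smul_right, b.orthonormal.1 k,
          real_inner_comm (b k) x, mul_one, Real.norm_eq_abs, sq_abs]
        nlinarith
      nlinarith [norm_nonneg (x + (-⟪b k, x⟫) • b k)]
  let G : Set (EuclideanSpace ℝ (Fin 3)) := {x | x ∈ K ∧ (‖x‖ ≤ 1 ∨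
    ∃ k : Fin 3, ∃ l : ℝ, l ≠ 0 ∧ x + l • b k ∈ interior K)}
  have hGaux : ∀ x y : EuclideanSpace ℝ (Fin 3), ∀ s t : ℝ, 0 < s → 0 ≤ t → s + t = 1 →
      y ∈ K → (∃ k : Fin 3, ∃ l : ℝ, l ≠ 0 ∧ x + l • b k ∈ interior K) →
      ∃ k : Fin 3, ∃ l : ℝ, l ≠ 0 ∧ (s • x + t • y) + l • b k ∈ interior K := by
    rintro x y s t hs ht hst hy ⟨k, l, hl, hx⟩
    refine ⟨k, s * l, mul_ne_zero hs.ne' hl, ?_⟩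
    have := hKconv.combo_interior_self_mem_interior hx hy hs ht hst
    convert this using 1
    module
  have hG : Convex ℝ G := by
    rw [convex_iff_forall_pos]
    rintro x ⟨hxK, hx⟩ y ⟨hyK, hy⟩ s t hs ht hst
    refine ⟨hKconv hxK hyK hs.le ht.le hst, ?_⟩
    rcases hx with hx | hx
    · rcases hy with hy | hy
      · left
        have := convex_closedBall (0 : EuclideanSpace ℝ (Fin 3)) 1
          (mem_closedBall_zero_iff.2 hx) (mem_closedBall_zero_iff.2 hy) hs.le ht.le hst
        exact mem_closedBall_zero_iff.1 this
      · right
        rw [add_comm (s • x)]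
        exact hGaux y x t s ht hs.le (by linarith) hxK hy
    · right
      exact hGaux x y s t hs ht.le hst hyK hx
  have hKG : K ⊆ G := by
    rw [hK]
    apply convexHull_min _ hG
    rintro x (hx | hx)
    · exact ⟨hsub (Or.inl hx), Or.inl (mem_closedBall_zero_iff.1 hx)⟩
    · obtain ⟨k, hk⟩ := hb x hx
      exact ⟨hsub (Or.inr hx), Or.inr ⟨k, move x k hk (hVout x hx).le⟩⟩
  intro p hp
  have hpK : p ∈ K := hKclosed.frontier_subset hp
  rcases (hKG hpK).2 with h | h
  · have hp1 : 1 ≤ ‖p‖ := by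
      by_contra! hlt
      exact hp.2 (hball (mem_ball_zero_iff.2 hlt))
    obtain ⟨k, hk⟩ := frame_small b p (by nlinarith)
    exact ⟨k, move p k hk hp1⟩
  · exact h

/-- The illumination number of a centrally symmetric cap body of a ball in
`E^3` is at most 6: there are six unit directions such that every boundary point of `K` is
illuminated by one of them. -/
theorem centrallySymmetric_capBody_illumination_le_six
    (V : Set (EuclideanSpace ℝ (Fin 3))) (hVfin : V.Finite)
    (hVout : ∀ v ∈ V, 1 < ‖v‖)
    (hVseg : ∀ v ∈ V, ∀ w ∈ V, v ≠ w →
      (segment ℝ v w ∩ Metric.closedBall (0 : EuclideanSpace ℝ (Fin 3)) 1).Nonempty)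
    (hVsym : -V = V)
    (K : Set (EuclideanSpace ℝ (Fin 3)))
    (hK : K = convexHull ℝ (Metric.closedBall (0 : EuclideanSpace ℝ (Fin 3)) 1 ∪ V)) :
    ∃ u : Fin 6 → EuclideanSpace ℝ (Fin 3), (∀ j, ‖u j‖ = 1) ∧
      ∀ p ∈ frontier K, ∃ j : Fin 6, ∃ l : ℝ, 0 < l ∧ p + l • u j ∈ interior K := by
  obtain ⟨b, hb⟩ := exists_good_frame V hVseg hVsym
  have hu : ∀ k, ‖b k‖ = 1 := b.orthonormal.1
  refine ⟨![b 0, b 1, b 2, -b 0, -b 1, -b 2], ?_, ?_⟩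
  · intro j
    fin_cases j <;> simp [hu]
  · intro p hp
    obtain ⟨k, l, hl, h⟩ := illum_of_frame V hVfin hVout b hb K hK p hp
    rcases lt_or_gt_of_ne hl with hl | hl
    · have h' : p + (-l) • (-b k) ∈ interior K := by simpa using h
      have hl' : 0 < -l := by linarith
      fin_cases k
      · exact ⟨3, -l, hl', h'⟩
      · exact ⟨4, -l, hl', h'⟩
      · exact ⟨5, -l, hl', h'⟩
    · fin_cases k
      · exact ⟨0, l, hl, h⟩
      · exact ⟨1, l, hl, h⟩
      · exact ⟨2, l, hl, h⟩
end

section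
/- Let {C(o_i, r_i)}_{i ∈ I} be a countable family of closed spherical caps on S^2 ⊂ E^3 with radii r_i ∈ (0, π/2), such that the caps have pairwise disjoint interiors, and the family is centrally symmetric: for each i ∈ I there is j ∈ I with o_j = -o_i and r_j = r_i. Then there exist three pairwise orthogonal unit vectors w_1, w_2, w_3 ∈ E^3 such that every cap C(o_i, r_i) is contained in {x ∈ S^2 : ⟨x, w_k⟩ > 0} or in {x ∈ S^2 : ⟨x, w_k⟩ < 0} for some k ∈ {1,2,3}. -/
open scoped RealInnerProductSpace

abbrev E3 := EuclideanSpace ℝ (Fin 3)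

lemma cap_sep (u v : E3) (r s : ℝ) (hu : ‖u‖ = 1) (hv : ‖v‖ = 1)
    (hr : r ∈ Set.Ioo 0 (Real.pi / 2)) (hs : s ∈ Set.Ioo 0 (Real.pi / 2))
    (hd : Disjoint {x : E3 | ‖x‖ = 1 ∧ Real.cos r < ⟪x, u⟫}
      {x : E3 | ‖x‖ = 1 ∧ Real.cos s < ⟪x, v⟫}) :
    ⟪u, v⟫ ≤ Real.cos r * Real.cos s - Real.sin r * Real.sin s := by
  obtain ⟨hr0, hr1⟩ := hr
  obtain ⟨hs0, hs1⟩ := hs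
  rw [← Real.cos_add]
  by_contra! hlt
  rw [Set.disjoint_left] at hd
  set t := InnerProductGeometry.angle u v with ht
  have hin : ⟪u, v⟫ = Real.cos t := by
    rw [ht, InnerProductGeometry.cos_angle, hu, hv]; simp
  have huu : ⟪u, u⟫ = 1 := by rw [real_inner_self_eq_norm_sq, hu]; norm_num
  have hvv : ⟪v, v⟫ = 1 := by rw [real_inner_self_eq_norm_sq, hv]; norm_num
  have ht0 : 0 ≤ t := InnerProductGeometry.angle_nonneg _ _
  have htpi : t ≤ Real.pi := InnerProductGeometry.angle_le_pi _ _
  have htlt : t < r + s := by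
    by_contra! hge
    have := Real.cos_le_cos_of_nonneg_of_le_pi (by linarith : 0 ≤ r + s) htpi hge
    linarith
  have hcos1 : ∀ a, 0 < a → a < Real.pi / 2 → Real.cos a < 1 := by
    intro a h0 h1
    have := Real.cos_lt_cos_of_nonneg_of_le_pi (le_refl (0:ℝ)) (by linarith [Real.pi_pos] : a ≤ Real.pi) h0
    simpa using this
  rcases ht0.eq_or_lt with h0 | hpos
  · have huv : u = v := by
      rw [← inner_eq_one_iff_of_norm_eq_one (𝕜 := ℝ) hu hv, hin, ← h0, Real.cos_zero]
    subst huv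
    exact hd (a := u) ⟨hu, by rw [huu]; exact hcos1 r hr0 hr1⟩
      ⟨hu, by rw [huu]; exact hcos1 s hs0 hs1⟩
  · have hst : 0 < Real.sin t := Real.sin_pos_of_pos_of_lt_pi hpos (by linarith)
    obtain ⟨a, ha0, har, hb0, hbs⟩ : ∃ a, 0 ≤ a ∧ a < r ∧ 0 ≤ t - a ∧ t - a < s := by
      refine ⟨t * (r / (r + s)), by positivity, ?_, ?_, ?_⟩
      · rw [← mul_div_assoc, div_lt_iff₀ (by linarith)]; nlinarith
      · have : r / (r + s) ≤ 1 := by rw [div_le_one (by linarith)]; linarith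
        nlinarith
      · have : t - t * (r / (r + s)) = t * s / (r + s) := by field_simp; ring
        rw [this, div_lt_iff₀ (by linarith)]; nlinarith
    set x : E3 := (Real.sin t)⁻¹ • (Real.sin (t - a) • u + Real.sin a • v) with hx
    have hvu : ⟪v, u⟫ = Real.cos t := by rw [real_inner_comm, hin]
    have hxu : ⟪x, u⟫ = Real.cos a := by
      rw [hx, inner_smul_left, inner_add_left, inner_smul_left, inner_smul_left, huu, hvu,
        Real.sin_sub]
      simp only [conj_trivial]
      field_simp; ring
    have hxv : ⟪x, v⟫ = Real.cos (t - a) := by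
      rw [hx, inner_smul_left, inner_add_left, inner_smul_left, inner_smul_left, hvv, hin,
        Real.sin_sub, Real.cos_sub]
      simp only [conj_trivial]
      field_simp
      have := Real.sin_sq_add_cos_sq t
      linear_combination Real.sin a * (-this)
    have hxx : ⟪x, x⟫ = 1 := by
      conv_lhs => rw [hx]
      rw [inner_smul_left, inner_add_left, inner_smul_left, inner_smul_left,
        real_inner_comm, hxu, real_inner_comm, hxv]
      simp only [conj_trivial]
      have : Real.sin t = Real.sin (t - a) * Real.cos a + Real.sin a * Real.cos (t - a) := by
        have := Real.sin_add (t - a) a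
        rw [sub_add_cancel] at this
        linarith
      rw [← this]
      field_simp
    have hxn : ‖x‖ = 1 := by
      rw [real_inner_self_eq_norm_sq] at hxx
      nlinarith [norm_nonneg x]
    refine hd (a := x) ⟨hxn, ?_⟩ ⟨hxn, ?_⟩
    · rw [hxu]; exact Real.cos_lt_cos_of_nonneg_of_le_pi ha0 (by linarith) har
    · rw [hxv]; exact Real.cos_lt_cos_of_nonneg_of_le_pi hb0 (by linarith) hbs

lemma cap_hemi (u w : E3) (r : ℝ) (hu : ‖u‖ = 1) (hw : ‖w‖ = 1)
    (hr : r ∈ Set.Ioo 0 (Real.pi / 2)) (h : Real.sin r < ⟪u, w⟫)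
    (x : E3) (hx : ‖x‖ = 1) (hxu : Real.cos r ≤ ⟪x, u⟫) : 0 < ⟪x, w⟫ := by
  obtain ⟨hr0, hr1⟩ := hr
  have key := InnerProductGeometry.angle_le_angle_add_angle x u w
  have h1 : InnerProductGeometry.angle x u ≤ r := by
    by_contra! hlt
    have := Real.cos_lt_cos_of_nonneg_of_le_pi hr0.le (InnerProductGeometry.angle_le_pi x u) hlt
    rw [InnerProductGeometry.cos_angle, hx, hu] at this
    simp at this; linarith
  have h2 : InnerProductGeometry.angle u w < Real.pi / 2 - r := by
    by_contra! hle
    have := Real.cos_le_cos_of_nonneg_of_le_pi (by linarith) (InnerProductGeometry.angle_le_pi u w) hle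
    rw [InnerProductGeometry.cos_angle, hu, hw, Real.cos_pi_div_two_sub] at this
    simp at this; linarith
  have h3 : 0 < Real.cos (InnerProductGeometry.angle x w) :=
    Real.cos_pos_of_mem_Ioo ⟨by linarith [InnerProductGeometry.angle_nonneg x w, Real.pi_pos], by linarith⟩
  rw [InnerProductGeometry.cos_angle, hx, hw] at h3
  simpa using h3

lemma frame (u v : E3) : ∃ b : OrthonormalBasis (Fin 3) ℝ E3,
    ⟪b 1, u⟫ = 0 ∧ ⟪b 2, u⟫ = 0 ∧ ⟪b 2, v⟫ = 0 := by
  have h : Module.finrank ℝ E3 = Fintype.card (Fin 3) := by simp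
  refine ⟨InnerProductSpace.gramSchmidtOrthonormalBasis h ![u, v, 0], ?_, ?_, ?_⟩
  · exact InnerProductSpace.gramSchmidtOrthonormalBasis_inv_triangular h ![u, v, 0] (i := 0) (j := 1) (by decide)
  · exact InnerProductSpace.gramSchmidtOrthonormalBasis_inv_triangular h ![u, v, 0] (i := 0) (j := 2) (by decide)
  · exact InnerProductSpace.gramSchmidtOrthonormalBasis_inv_triangular h ![u, v, 0] (i := 1) (j := 2) (by decide)

lemma pair_bound (s c s' c' g : ℝ) (hs : 0 < s) (hc : 0 < c) (hs' : 0 < s') (hc' : 0 < c')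
    (h : s ^ 2 + c ^ 2 = 1) (h' : s' ^ 2 + c' ^ 2 = 1) (hB : 1 ≤ 3 * s ^ 2) (hB' : 1 ≤ 3 * s' ^ 2)
    (hg : |g| ≤ c * c' - s * s') :
    |g| ≤ 1 / 3 ∧ s ^ 2 ≤ 2 / 3 ∧ (4 / 9 ≤ s ^ 2 → |g| ≤ 1 / 4) := by
  have e1 : (c * c') ^ 2 = (1 - s ^ 2) * (1 - s' ^ 2) := by
    rw [mul_pow, show c ^ 2 = 1 - s ^ 2 by linarith, show c' ^ 2 = 1 - s' ^ 2 by linarith]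
  have e2 : (s * s') ^ 2 = s ^ 2 * s' ^ 2 := by ring
  have p1 : 0 < c * c' := by positivity
  have p2 : 0 < s * s' := by positivity
  have hb : s ^ 2 < 1 := by nlinarith
  have hb' : s' ^ 2 < 1 := by nlinarith
  generalize c * c' = C at *
  generalize s * s' = S at *
  generalize s ^ 2 = a at *
  generalize s' ^ 2 = a' at *
  have g0 := abs_nonneg g
  refine ⟨?_, ?_, ?_⟩
  · have : C ≤ 2 / 3 := by
      by_contra! hh
      nlinarith [mul_nonneg (by linarith : 0 ≤ 1 - a) (by linarith : 0 ≤ a' - 1 / 3)]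
    have : 1 / 3 ≤ S := by
      by_contra! hh
      nlinarith
    linarith
  · nlinarith
  · intro h4
    have : C ≤ 61 / 100 := by
      by_contra! hh
      nlinarith [mul_nonneg (by linarith : 0 ≤ 1 - a) (by linarith : 0 ≤ a' - 1 / 3)]
    have : 38 / 100 ≤ S := by
      by_contra! hh
      nlinarith
    linarith

/-- The coordinate inequality for a big cap different from the two reference ones. -/
lemma third_coord (e p q x y z t : ℝ) (he : e ^ 2 = 1) (hpq : p ^ 2 + q ^ 2 = 1)
    (hxyz : x ^ 2 + y ^ 2 + z ^ 2 = 1)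
    (h12 : |e * p| ≤ 1 / 3) (h1 : |e * x| ≤ 1 / 3)
    (ht : t ≤ 2 / 3)
    (h1' : 4 / 9 ≤ t → |e * x| ≤ 1 / 4) (h2' : 4 / 9 ≤ t → |p * x + q * y| ≤ 1 / 4) :
    t < y ^ 2 ∨ t < z ^ 2 := by
  have hae : |e| = 1 := by rw [← sq_abs] at he; nlinarith [abs_nonneg e]
  rw [abs_mul, hae, one_mul] at h12 h1 h1'
  have hx2 : x ^ 2 ≤ 1 / 9 := by rw [← sq_abs]; nlinarith [abs_nonneg x]
  have hp2 : p ^ 2 ≤ 1 / 9 := by rw [← sq_abs]; nlinarith [abs_nonneg p]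
  by_cases h : 4 / 9 ≤ t
  · right
    have a1 := h1' h
    have a2 := h2' h
    have hx3 : x ^ 2 ≤ 1 / 16 := by rw [← sq_abs]; nlinarith [abs_nonneg x]
    have hpx : |p * x| ≤ 1 / 12 := by
      rw [abs_mul]; nlinarith [abs_nonneg x, abs_nonneg p]
    have hqy : |q * y| ≤ 1 / 3 := by
      rw [abs_le] at *
      constructor <;> linarith
    have : q ^ 2 * y ^ 2 ≤ 1 / 9 := by
      rw [← mul_pow, ← sq_abs]; nlinarith [abs_nonneg (q * y)]
    have : y ^ 2 ≤ 1 / 8 := by nlinarith [sq_nonneg y]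
    linarith
  · by_contra! hh
    linarith

/-- A countable centrally symmetric packing of closed spherical caps
`C(o_i, r_i)` (radii in `(0, π/2)`) on `S² ⊂ E³` can be separated by three pairwise orthogonal
greatspheres: there are pairwise orthogonal unit vectors `w_1, w_2, w_3` such that every cap
lies in an open hemisphere `{⟪·, w_k⟫ > 0}` or `{⟪·, w_k⟫ < 0}`. -/
theorem centrallySymmetric_capPacking_separated_by_three_greatspheres
    (I : Type) [Countable I]
    (o : I → EuclideanSpace ℝ (Fin 3)) (r : I → ℝ)
    (ho : ∀ i, ‖o i‖ = 1) (hr : ∀ i, r i ∈ Set.Ioo 0 (Real.pi / 2))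
    (hpack : ∀ i j, i ≠ j → Disjoint
      {x : EuclideanSpace ℝ (Fin 3) | ‖x‖ = 1 ∧ Real.cos (r i) < ⟪x, o i⟫}
      {x : EuclideanSpace ℝ (Fin 3) | ‖x‖ = 1 ∧ Real.cos (r j) < ⟪x, o j⟫})
    (hsym : ∀ i, ∃ j, o j = -o i ∧ r j = r i) :
    ∃ w : Fin 3 → EuclideanSpace ℝ (Fin 3),
      (∀ k, ‖w k‖ = 1) ∧ (∀ k l, k ≠ l → ⟪w k, w l⟫ = 0) ∧
      ∀ i, ∃ k : Fin 3,
        ({x : EuclideanSpace ℝ (Fin 3) | ‖x‖ = 1 ∧ Real.cos (r i) ≤ ⟪x, o i⟫} ⊆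
            {x : EuclideanSpace ℝ (Fin 3) | ‖x‖ = 1 ∧ 0 < ⟪x, w k⟫}) ∨
        ({x : EuclideanSpace ℝ (Fin 3) | ‖x‖ = 1 ∧ Real.cos (r i) ≤ ⟪x, o i⟫} ⊆
            {x : EuclideanSpace ℝ (Fin 3) | ‖x‖ = 1 ∧ ⟪x, w k⟫ < 0}) := by
  classical
  -- it suffices to control squares of coordinates
  suffices hmain : ∃ b : OrthonormalBasis (Fin 3) ℝ E3,
      ∀ i, ∃ k, Real.sin (r i) ^ 2 < ⟪o i, b k⟫ ^ 2 by
    obtain ⟨b, hb⟩ := hmain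
    refine ⟨b, fun k => b.orthonormal.1 k, fun k l hkl => b.orthonormal.2 hkl, fun i => ?_⟩
    obtain ⟨k, hk⟩ := hb i
    have hs : 0 ≤ Real.sin (r i) :=
      Real.sin_nonneg_of_nonneg_of_le_pi (hr i).1.le (by linarith [(hr i).2, Real.pi_pos])
    have hk2 : Real.sin (r i) < ⟪o i, b k⟫ ∨ ⟪o i, b k⟫ < -Real.sin (r i) := by
      by_contra! hh
      nlinarith [hh.1, hh.2]
    refine ⟨k, ?_⟩
    rcases hk2 with h | h
    · left
      rintro x ⟨hx, hxo⟩
      exact ⟨hx, cap_hemi (o i) (b k) (r i) (ho i) (b.orthonormal.1 k) (hr i) h x hx hxo⟩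
    · right
      rintro x ⟨hx, hxo⟩
      refine ⟨hx, ?_⟩
      have := cap_hemi (o i) (-b k) (r i) (ho i) (by rw [norm_neg]; exact b.orthonormal.1 k) (hr i)
        (by rw [inner_neg_right]; linarith) x hx hxo
      rw [inner_neg_right] at this
      linarith
  have hsp : ∀ i, 0 < Real.sin (r i) := fun i =>
    Real.sin_pos_of_pos_of_lt_pi (hr i).1 (by linarith [(hr i).2, Real.pi_pos])
  have hcp : ∀ i, 0 < Real.cos (r i) := fun i =>
    Real.cos_pos_of_mem_Ioo ⟨by linarith [(hr i).1, Real.pi_pos], (hr i).2⟩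
  have hsep : ∀ i j, o i ≠ o j → o i ≠ -o j →
      |⟪o i, o j⟫| ≤ Real.cos (r i) * Real.cos (r j) - Real.sin (r i) * Real.sin (r j) := by
    intro i j h1 h2
    obtain ⟨j', hj', hrj'⟩ := hsym j
    have a1 := cap_sep (o i) (o j) (r i) (r j) (ho i) (ho j) (hr i) (hr j)
      (hpack i j (fun h => h1 (by rw [h])))
    have a2 := cap_sep (o i) (o j') (r i) (r j') (ho i) (ho j') (hr i) (hr j')
      (hpack i j' (fun h => h2 (by rw [← hj', h])))
    rw [hj', hrj', inner_neg_right] at a2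
    rw [abs_le]
    constructor <;> linarith
  have hpb := fun i j (hi : 1 ≤ 3 * Real.sin (r i) ^ 2) (hj : 1 ≤ 3 * Real.sin (r j) ^ 2) h1 h2 =>
    pair_bound (Real.sin (r i)) (Real.cos (r i)) (Real.sin (r j)) (Real.cos (r j)) ⟪o i, o j⟫
      (hsp i) (hcp i) (hsp j) (hcp j) (Real.sin_sq_add_cos_sq _) (Real.sin_sq_add_cos_sq _)
      hi hj (hsep i j h1 h2)
  have hexp : ∀ (b : OrthonormalBasis (Fin 3) ℝ E3) (u v : E3),
      ⟪u, v⟫ = ⟪u, b 0⟫ * ⟪v, b 0⟫ + ⟪u, b 1⟫ * ⟪v, b 1⟫ + ⟪u, b 2⟫ * ⟪v, b 2⟫ := by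
    intro b u v
    rw [← b.sum_inner_mul_inner u v, Fin.sum_univ_three, real_inner_comm v (b 0),
      real_inner_comm v (b 1), real_inner_comm v (b 2)]
  have hnorm : ∀ (b : OrthonormalBasis (Fin 3) ℝ E3) i,
      ⟪o i, b 0⟫ ^ 2 + ⟪o i, b 1⟫ ^ 2 + ⟪o i, b 2⟫ ^ 2 = 1 := by
    intro b i
    have h := hexp b (o i) (o i)
    rw [real_inner_self_eq_norm_sq, ho i] at h
    linarith
  have hsmall : ∀ (b : OrthonormalBasis (Fin 3) ℝ E3) i, ¬ 1 ≤ 3 * Real.sin (r i) ^ 2 →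
      ∃ k, Real.sin (r i) ^ 2 < ⟪o i, b k⟫ ^ 2 := by
    intro b i hi
    by_contra! hh
    have := hnorm b i
    linarith [hh 0, hh 1, hh 2]
  have hlt1 : ∀ i, Real.sin (r i) ^ 2 < 1 := fun i => by
    have := Real.sin_sq_add_cos_sq (r i)
    nlinarith [hcp i]
  by_cases hB : ∃ i, 1 ≤ 3 * Real.sin (r i) ^ 2
  swap
  · push Not at hB
    exact ⟨EuclideanSpace.basisFun (Fin 3) ℝ, fun i => hsmall _ i (not_le.2 (hB i))⟩
  obtain ⟨i1, hi1⟩ := hB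
  by_cases hB2 : ∃ i, 1 ≤ 3 * Real.sin (r i) ^ 2 ∧ o i ≠ o i1 ∧ o i ≠ -o i1
  swap
  · obtain ⟨b, hb1, hb2, -⟩ := frame (o i1) (o i1)
    rw [real_inner_comm] at hb1 hb2
    have hn := hnorm b i1
    rw [hb1, hb2] at hn
    refine ⟨b, fun i => ?_⟩
    by_cases hi : 1 ≤ 3 * Real.sin (r i) ^ 2
    swap
    · exact hsmall b i hi
    refine ⟨0, ?_⟩
    have : o i = o i1 ∨ o i = -o i1 := by
      by_contra! hh
      exact hB2 ⟨i, hi, hh⟩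
    have h1 := hlt1 i
    rcases this with h | h <;> rw [h]
    · linarith
    · rw [inner_neg_left]; linarith
  obtain ⟨i2, hi2, h21, h21'⟩ := hB2
  obtain ⟨b, hb1, hb2, hb3⟩ := frame (o i1) (o i2)
  rw [real_inner_comm] at hb1 hb2 hb3
  have hn1 := hnorm b i1
  rw [hb1, hb2] at hn1
  have hn2 := hnorm b i2
  rw [hb3] at hn2
  have g12 := (hpb i2 i1 hi2 hi1 h21 h21').1
  rw [hexp b, hb1, hb2, hb3] at g12
  refine ⟨b, fun i => ?_⟩
  by_cases hi : 1 ≤ 3 * Real.sin (r i) ^ 2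
  swap
  · exact hsmall b i hi
  have h1 := hlt1 i
  by_cases c1 : o i = o i1
  · refine ⟨0, ?_⟩
    rw [c1]; linarith
  by_cases c1' : o i = -o i1
  · refine ⟨0, ?_⟩
    rw [c1', inner_neg_left]; linarith
  obtain ⟨k1, k2, k3⟩ := hpb i i1 hi hi1 c1 c1'
  rw [hexp b, hb1, hb2] at k1 k3
  have hn := hnorm b i
  have key2 : ⟪o i, b 2⟫ = 0 → ∃ k, Real.sin (r i) ^ 2 < ⟪o i, b k⟫ ^ 2 := by
    intro hz
    refine ⟨1, ?_⟩
    rw [hz] at hn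
    have hx : (⟪o i, b 0⟫ * ⟪o i1, b 0⟫) ^ 2 ≤ 1 / 9 := by
      rw [← sq_abs]
      simp only [mul_zero, add_zero] at k1
      nlinarith [abs_nonneg (⟪o i, b 0⟫ * ⟪o i1, b 0⟫)]
    rw [mul_pow, show ⟪o i1, b 0⟫ ^ 2 = 1 by linarith] at hx
    linarith
  by_cases c2 : o i = o i2
  · exact key2 (by rw [c2, hb3])
  by_cases c2' : o i = -o i2
  · exact key2 (by rw [c2', inner_neg_left, hb3, neg_zero])
  obtain ⟨l1, l2, l3⟩ := hpb i i2 hi hi2 c2 c2'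
  rw [hexp b, hb3] at l3
  have := third_coord ⟪o i1, b 0⟫ ⟪o i2, b 0⟫ ⟪o i2, b 1⟫ ⟪o i, b 0⟫ ⟪o i, b 1⟫ ⟪o i, b 2⟫
    (Real.sin (r i) ^ 2) (by linarith) (by linarith) hn
    (by simpa [mul_comm] using g12) (by simpa [mul_comm] using k1) k2
    (fun h => by have := k3 h; simpa [mul_comm] using this)
    (fun h => by have := l3 h; simpa [mul_comm] using this)
  rcases this with h | h
  · exact ⟨1, h⟩
  · exact ⟨2, h⟩
end
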